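/- arXiv:0912.0637 — 2 statements merged into one kernel-verified Lean document; each statement's English description precedes it below -/
import Mathlib

section
/- Let R be a Noetherian graded *local ring with *maximal ideal m such that R/m is a field, and let A be a finitely generated graded R-module. Then, without any Cohen-Macaulay hypothesis, the depth of A over R equals the depth of the localized module A_m over the local ring R_m, and the Krull dimension of A over R equals the Krull dimension of A_m over R_m. In particular, for every maximal ideal m' of R one has dim A_{m'} ≤ dim A_m. -/
/-- The grade of an ideal `I` on a module `A`: the supremum of the lengths of
`A`-regular sequences consisting of elements of `I`.  For the *maximal ideal `m` of a
Noetherian graded *local ring (resp. the maximal ideal of a Noetherian local ring) and a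
finitely generated module `A` this is the depth of `A`, i.e. the length of a maximal
`A`-regular sequence in `m`. -/
noncomputable def Ideal.moduleGrade {R : Type*} [CommRing R] (I : Ideal R)
    (A : Type*) [AddCommGroup A] [Module R A] : ℕ∞ :=
  sSup {n : ℕ∞ | ∃ rs : List R, (rs.length : ℕ∞) = n ∧ (∀ r ∈ rs, r ∈ I) ∧
    RingTheory.Sequence.IsRegular A rs}

/-- The Krull dimension of the module `A` over `R`: the Krull dimension of the ring
`R ⧸ Ann(A)`, where `Ann(A) = {r ∈ R | r • A = 0}`. -/
noncomputable def Module.krullDimension (R : Type*) [CommRing R]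
    (A : Type*) [AddCommGroup A] [Module R A] : WithBot ℕ∞ :=
  ringKrullDim (R ⧸ Module.annihilator R A)

/-- `A` is a Cohen-Macaulay module with respect to the ideal `m` (the *maximal ideal in
the graded *local case, the maximal ideal in the local case): the depth of `A`, computed
as `grade(m, A)`, equals the Krull dimension of `A`. -/
def Module.IsCohenMacaulayWrt {R : Type*} [CommRing R] (m : Ideal R)
    (A : Type*) [AddCommGroup A] [Module R A] : Prop :=
  (Ideal.moduleGrade m A : WithBot ℕ∞) = Module.krullDimension R A

/-- `m` is a *maximal ideal of the `ℤ`-graded ring `R` with grading `𝒜`: a graded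
(homogeneous) proper ideal which is maximal among graded proper ideals. -/
def Ideal.IsStarMaximal {R : Type*} [CommRing R] (𝒜 : ℤ → AddSubgroup R) [GradedRing 𝒜]
    (m : Ideal R) : Prop :=
  Ideal.IsHomogeneous 𝒜 m ∧ m ≠ ⊤ ∧
    ∀ I : Ideal R, Ideal.IsHomogeneous 𝒜 I → I ≠ ⊤ → m ≤ I → I = m

section GradedPrimes

variable {R : Type*} [CommRing R] (𝒜 : ℤ → AddSubgroup R) [GradedRing 𝒜]

open DirectSum

/-- All homogeneous components of `x` of degree outside `[a, b]` lie in the ideal `P`. -/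
def Ideal.SupportedMod (P : Ideal R) (a b : ℤ) (x : R) : Prop :=
  ∀ i, (decompose 𝒜 x i : R) ∉ P → a ≤ i ∧ i ≤ b

namespace Ideal.SupportedMod

variable {𝒜} {P : Ideal R} {a b a' b' i : ℤ} {x y c : R}

theorem mono (h : P.SupportedMod 𝒜 a b x) (ha : a' ≤ a) (hb : b ≤ b') :
    P.SupportedMod 𝒜 a' b' x :=
  fun i hi ↦ ⟨ha.trans (h i hi).1, (h i hi).2.trans hb⟩

theorem zero : P.SupportedMod 𝒜 a b (0 : R) := fun i hi ↦ by simp at hi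

theorem add (hx : P.SupportedMod 𝒜 a b x) (hy : P.SupportedMod 𝒜 a b y) :
    P.SupportedMod 𝒜 a b (x + y) := fun i hi ↦ by
  by_cases h : (decompose 𝒜 x i : R) ∈ P
  · refine hy i fun h' ↦ hi ?_
    simpa [decompose_add] using P.add_mem h h'
  · exact hx i h

theorem sub (hx : P.SupportedMod 𝒜 a b x) (hy : P.SupportedMod 𝒜 a b y) :
    P.SupportedMod 𝒜 a b (x - y) := fun i hi ↦ by
  by_cases h : (decompose 𝒜 x i : R) ∈ P
  · refine hy i fun h' ↦ hi ?_
    simpa [decompose_sub] using P.sub_mem h h'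
  · exact hx i h

theorem mul_left (hc : c ∈ 𝒜 i) (hx : P.SupportedMod 𝒜 a b x) :
    P.SupportedMod 𝒜 (i + a) (i + b) (c * x) := fun j hj ↦ by
  obtain ⟨k, rfl⟩ : ∃ k, j = i + k := ⟨j - i, by ring⟩
  rw [coe_decompose_mul_add_of_left_mem 𝒜 hc] at hj
  have := hx k fun h ↦ hj (P.mul_mem_left c h)
  omega

theorem of_mem (hx : x ∈ 𝒜 i) : P.SupportedMod 𝒜 i i x := fun j hj ↦ by
  have : j = i := by
    by_contra h
    rw [decompose_of_mem_ne 𝒜 hx (Ne.symm h)] at hj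
    exact hj P.zero_mem
  omega

theorem mem_of_lt (hP : P.IsHomogeneous 𝒜) (hx : P.SupportedMod 𝒜 a b x) (h : b < a) : x ∈ P := by
  rw [hP.mem_iff]
  intro i
  by_contra hi
  have := hx i hi
  omega

theorem sub_one (hx : P.SupportedMod 𝒜 a b x) (hb : (decompose 𝒜 x b : R) ∈ P) :
    P.SupportedMod 𝒜 a (b - 1) x := fun i hi ↦ by
  have h : i ≠ b := by rintro rfl; exact hi hb
  have := hx i hi
  omega

theorem exists_supportedMod (P : Ideal R) (x : R) :
    ∃ (a : ℤ) (n : ℕ), P.SupportedMod 𝒜 a (a + n) x := by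
  classical
  obtain ⟨u, hu⟩ := (decompose 𝒜 x).support.bddAbove
  obtain ⟨l, hl⟩ := (decompose 𝒜 x).support.bddBelow
  refine ⟨l, (u - l).toNat, fun i hi ↦ ?_⟩
  have hi' : i ∈ (decompose 𝒜 x).support := by
    rw [DFinsupp.mem_support_iff]
    rintro h
    simp [h] at hi
  have h₁ := hu hi'
  have h₂ := hl hi'
  omega

/-- Pseudo-division of elements of `p` by an element `f` of `p` of minimal width modulo `P`. -/
theorem exists_pow_mul_sub_mul_mem {p : Ideal R} {w : ℕ} (hw : 0 < w)
    (hmin : ∀ (n : ℕ) (a : ℤ) (g : R), g ∈ p → n < w → P.SupportedMod 𝒜 a (a + n) g → g ∈ P)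
    {f : R} (hf : f ∈ p) {d : ℤ} (hfd : P.SupportedMod 𝒜 (d - w) d f) (n : ℕ) :
    ∀ (a : ℤ) (g : R), g ∈ p → P.SupportedMod 𝒜 a (a + n) g →
      ∃ (N : ℕ) (h : R), (decompose 𝒜 f d : R) ^ N * g - h * f ∈ P ∧
        P.SupportedMod 𝒜 (a + N * d - d + w) (a + N * d + n - d) h := by
  set c : R := ((decompose 𝒜 f d : 𝒜 d) : R)
  have hcd : c ∈ 𝒜 d := SetLike.coe_mem _
  induction n with
  | zero =>
    intro a g hg ha
    exact ⟨0, 0, by simpa using hmin 0 a g hg hw ha, zero⟩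
  | succ n ih =>
    intro a g hg ha
    by_cases hn : n + 1 < w
    · exact ⟨0, 0, by simpa using hmin _ a g hg hn ha, zero⟩
    obtain ⟨t, ht⟩ : ∃ t : ℤ, t = a + (n + 1 : ℕ) := ⟨_, rfl⟩
    set g₀ : R := ((decompose 𝒜 g t : 𝒜 t) : R)
    have hgt : g₀ ∈ 𝒜 t := SetLike.coe_mem _
    have hg' : c * g - g₀ * f ∈ p := p.sub_mem (p.mul_mem_left _ hg) (p.mul_mem_left _ hf)
    have h₁ : P.SupportedMod 𝒜 (a + d) (t + d) (c * g - g₀ * f) :=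
      ((ha.mul_left hcd).mono (by omega) (by omega)).sub
        ((hfd.mul_left hgt).mono (by omega) (by omega))
    have h₂ : (decompose 𝒜 (c * g - g₀ * f) (t + d) : R) ∈ P := by
      have e₁ : (decompose 𝒜 (c * g) (t + d) : R) = c * g₀ := by
        rw [add_comm, coe_decompose_mul_add_of_left_mem 𝒜 hcd]
      have e₂ : (decompose 𝒜 (g₀ * f) (t + d) : R) = g₀ * c := by
        rw [coe_decompose_mul_add_of_left_mem 𝒜 hgt]
      rw [decompose_sub, DirectSum.sub_apply, AddSubgroupClass.coe_sub, e₁, e₂, mul_comm, sub_self]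
      exact P.zero_mem
    obtain ⟨N, h, hh, hs⟩ := ih (a + d) _ hg' ((h₁.sub_one h₂).mono le_rfl (by omega))
    have hN : c ^ N ∈ 𝒜 (N • d) := SetLike.pow_mem_graded N hcd
    refine ⟨N + 1, c ^ N * g₀ + h, ?_, ?_⟩
    · convert hh using 1
      ring
    · refine ((of_mem (SetLike.mul_mem_graded hN hgt)).mono ?_ ?_).add (hs.mono ?_ ?_) <;>
      · push_cast [nsmul_eq_mul]
        have : ((N : ℤ) + 1) * d = N * d + d := by ring
        omega

end Ideal.SupportedMod

/-- Let `P ≤ q ≤ p` be primes such that `P` is homogeneous and contains every homogeneous element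
of `p`. Then `q = P` or `q = p`. -/
theorem Ideal.IsHomogeneous.le_or_le_of_isPrime {P q p : Ideal R} (hP : P.IsHomogeneous 𝒜)
    (hPp : P.IsPrime) (hq : q.IsPrime) (hPq : P ≤ q) (hqp : q ≤ p)
    (hp : ∀ x ∈ p, SetLike.IsHomogeneousElem 𝒜 x → x ∈ P) : q ≤ P ∨ p ≤ q := by
  classical
  refine or_iff_not_imp_left.mpr fun hqP ↦ ?_
  obtain ⟨f₀, hf₀q, hf₀P⟩ := SetLike.not_le_iff_exists.mp hqP
  have hex : ∃ w : ℕ, ∃ (a : ℤ) (g : R), g ∈ p ∧ g ∉ P ∧ P.SupportedMod 𝒜 a (a + w) g := by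
    obtain ⟨a, n, h⟩ := Ideal.SupportedMod.exists_supportedMod (𝒜 := 𝒜) P f₀
    exact ⟨n, a, f₀, hqp hf₀q, hf₀P, h⟩
  obtain ⟨w, ⟨e, f, hfp, hfP, hfe⟩, hmin⟩ : ∃ w : ℕ,
      (∃ (a : ℤ) (g : R), g ∈ p ∧ g ∉ P ∧ P.SupportedMod 𝒜 a (a + w) g) ∧
      ∀ (n : ℕ) (a : ℤ) (g : R), g ∈ p → n < w → P.SupportedMod 𝒜 a (a + n) g → g ∈ P := by
    refine ⟨Nat.find hex, Nat.find_spec hex, fun n a g hg hn h ↦ ?_⟩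
    by_contra hgP
    exact Nat.find_min hex hn ⟨a, g, hg, hgP, h⟩
  obtain ⟨d, hd⟩ : ∃ d : ℤ, d = e + w := ⟨_, rfl⟩
  have hfd : P.SupportedMod 𝒜 (d - w) d f := hfe.mono (by omega) (by omega)
  have hcP : (decompose 𝒜 f d : R) ∉ P := by
    intro hc
    have h := hfd.sub_one hc
    rcases Nat.eq_zero_or_pos w with rfl | hw
    · exact hfP (h.mem_of_lt hP (by simp))
    · exact hfP (hmin (w - 1) e f hfp (by omega) (h.mono (by omega) (by omega)))
  have hcp : (decompose 𝒜 f d : R) ∉ p := fun h ↦ hcP (hp _ h ⟨d, SetLike.coe_mem _⟩)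
  have hw : 0 < w := by
    rcases Nat.eq_zero_or_pos w with rfl | hw
    · refine absurd ?_ hcp
      have h : f - decompose 𝒜 f d ∈ P := by
        have h₁ : P.SupportedMod 𝒜 d d (f - decompose 𝒜 f d) :=
          (hfd.mono (by simp) le_rfl).sub (.of_mem (SetLike.coe_mem _))
        refine (h₁.sub_one ?_).mem_of_lt hP (by simp)
        simp [decompose_sub]
      have := p.sub_mem hfp (hqp (hPq h))
      simpa using this
    · exact hw
  have hdiv := Ideal.SupportedMod.exists_pow_mul_sub_mul_mem hw hmin hfp hfd
  have hfq : f ∈ q := by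
    by_contra hfq
    have key : ∀ (n : ℕ) (a : ℤ) (g : R), g ∈ q → P.SupportedMod 𝒜 a (a + n) g → g ∈ P := by
      intro n
      induction n using Nat.strong_induction_on with
      | _ n ih =>
        intro a g hg ha
        by_cases hn : n < w
        · exact hmin n a g (hqp hg) hn ha
        obtain ⟨N, h, hN, hh⟩ := hdiv n a g (hqp hg) ha
        have hhq : h ∈ q := by
          refine (hq.mem_or_mem (?_ : h * f ∈ q)).resolve_right hfq
          have := q.sub_mem (q.mul_mem_left ((decompose 𝒜 f d : R) ^ N) hg) (hPq hN)
          simpa using this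
        have hhP : h ∈ P := ih (n - w) (by omega) _ h hhq (hh.mono le_rfl (by omega))
        have := P.add_mem hN (P.mul_mem_right f hhP)
        rw [sub_add_cancel] at this
        exact (hPp.mem_or_mem this).resolve_left fun h ↦ hcP (hPp.mem_of_pow_mem _ h)
    obtain ⟨a, n, h⟩ := Ideal.SupportedMod.exists_supportedMod (𝒜 := 𝒜) P f₀
    exact hf₀P (key n a f₀ hf₀q h)
  intro g hg
  obtain ⟨a, n, ha⟩ := Ideal.SupportedMod.exists_supportedMod (𝒜 := 𝒜) P g
  obtain ⟨N, h, hN, -⟩ := hdiv n a g hg ha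
  have := q.add_mem (hPq hN) (q.mul_mem_left h hfq)
  rw [sub_add_cancel] at this
  exact (hq.mem_or_mem this).resolve_left fun h ↦ hcp (hqp (hq.mem_of_pow_mem _ h))

end GradedPrimes

section Depth

open RingTheory.Sequence IsLocalRing CategoryTheory Abelian

universe u v

/-- In a Noetherian local ring, if `M` has a regular sequence of length `n + 1`, then `M / yM`
has one of length `n`, for every `M`-regular element `y` of the maximal ideal. -/
theorem IsLocalRing.exists_isRegular_quotSMulTop {R : Type u} [CommRing R] [IsLocalRing R]
    [IsNoetherianRing R] [Small.{v} R] {M : Type v} [AddCommGroup M] [Module R M]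
    [Module.Finite R M] {rs : List R} {n : ℕ} (hlen : rs.length = n + 1)
    (hmem : ∀ r ∈ rs, r ∈ maximalIdeal R) (hreg : IsRegular M rs) {y : R}
    (hy : y ∈ maximalIdeal R) (hyreg : IsSMulRegular M y) :
    ∃ ts : List R, ts.length = n ∧ (∀ r ∈ ts, r ∈ maximalIdeal R) ∧
      IsRegular (QuotSMulTop y M) ts := by
  have : Nontrivial M := hreg.nontrivial
  have lt_top (L : Type v) [AddCommGroup L] [Module R L] [Module.Finite R L] [Nontrivial L] :
      maximalIdeal R • (⊤ : Submodule R L) < ⊤ :=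
    (Submodule.top_ne_ideal_smul_of_le_jacobson_annihilator
      (maximalIdeal_le_jacobson _)).symm.lt_top
  have := nontrivial_quotSMulTop_of_mem_maximalIdeal M hy
  let k : ModuleCat.{v} R := ModuleCat.of R (Shrink.{v} (R ⧸ maximalIdeal R))
  have h₀ : ∃ rs : List R, rs.length = n + 1 ∧ (∀ r ∈ rs, r ∈ maximalIdeal R) ∧
      IsRegular (ModuleCat.of R M) rs := ⟨rs, hlen, hmem, hreg⟩
  have h₁ : ∀ i < n + 1, Subsingleton (Ext k (ModuleCat.of R M) i) :=
    ((ModuleCat.exists_isRegular_tfae (maximalIdeal R) (n + 1) (ModuleCat.of R M)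
      (lt_top M)).out 3 1).mp h₀
  refine ((ModuleCat.exists_isRegular_tfae (maximalIdeal R) n (ModuleCat.of R (QuotSMulTop y M))
      (lt_top _)).out 1 3).mp fun i hi ↦ ?_
  have zero₁ := AddCommGrpCat.isZero_of_iff_subsingleton.mpr (h₁ i (by omega))
  have zero₂ := AddCommGrpCat.isZero_of_iff_subsingleton.mpr (h₁ (i + 1) (by omega))
  have hyreg' : IsSMulRegular (ModuleCat.of R M) y := hyreg
  exact AddCommGrpCat.subsingleton_of_isZero <| ShortComplex.Exact.isZero_of_both_zeros
    ((Ext.covariant_sequence_exact₃' k hyreg'.smulShortComplex_shortExact) i (i + 1) rfl)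
    (zero₁.eq_zero_of_src _) (zero₂.eq_zero_of_tgt _)

open TensorProduct in
/-- A regular sequence in the localization at a maximal ideal `m` gives a regular sequence in `m`
of the same length. -/
theorem Ideal.IsMaximal.exists_isRegular_of_tensorProduct {R : Type u} [CommRing R]
    [IsNoetherianRing R] (m : Ideal R) [hm : m.IsMaximal] (n : ℕ) :
    ∀ (A : Type v) [AddCommGroup A] [Module R A] [Module.Finite R A]
      (rs : List (Localization.AtPrime m)), rs.length = n →
      (∀ r ∈ rs, r ∈ maximalIdeal (Localization.AtPrime m)) →
      IsRegular (Localization.AtPrime m ⊗[R] A) rs →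
      ∃ ts : List R, ts.length = n ∧ (∀ r ∈ ts, r ∈ m) ∧ IsRegular A ts := by
  have : IsNoetherianRing (Localization.AtPrime m) :=
    IsLocalization.isNoetherianRing m.primeCompl _ inferInstance
  induction n with
  | zero =>
    intro A _ _ _ rs hlen _ hreg
    have := hreg.nontrivial
    have : Nontrivial A := by
      by_contra h
      rw [not_nontrivial_iff_subsingleton] at h
      exact not_subsingleton (Localization.AtPrime m ⊗[R] A) inferInstance
    exact ⟨[], rfl, by simp, .nil R A⟩
  | succ n ih =>
    intro A _ _ _ rs hlen hmem hreg
    have hass : m ∉ associatedPrimes R A := by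
      intro h
      have h' :=
        Module.associatedPrimes.mem_associatedPrimes_of_comap_mem_associatedPrimes_of_isLocalizedModule
          (M' := Localization.AtPrime m ⊗[R] A) (R' := Localization.AtPrime m)
        m.primeCompl (TensorProduct.mk R (Localization.AtPrime m) A 1)
        (maximalIdeal (Localization.AtPrime m))
        (by simpa [Localization.AtPrime.under_maximalIdeal] using h)
      obtain _ | ⟨r, rs⟩ := rs
      · simp at hlen
      have h₁ := ((isRegular_cons_iff _ _ _).mp hreg).1
      have h₂ : r ∈ ⋃ p ∈ associatedPrimes (Localization.AtPrime m)
          (Localization.AtPrime m ⊗[R] A), (p : Set _) :=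
        Set.mem_biUnion h' (hmem r List.mem_cons_self)
      rw [biUnion_associatedPrimes_eq_compl_regular] at h₂
      exact h₂ h₁
    obtain ⟨y, hym, hy⟩ : ∃ y ∈ m, IsSMulRegular A y := by
      by_contra! h
      have h₁ : (m : Set R) ⊆ ⋃ p ∈ associatedPrimes R A, p := by
        rw [biUnion_associatedPrimes_eq_compl_regular R A]
        exact fun r hr ↦ h r hr
      obtain ⟨p, hp, hmp⟩ := (Ideal.subset_union_prime_finite (associatedPrimes.finite R A)
        (f := id) ⊥ ⊥ fun I hI _ _ ↦ IsAssociatedPrime.isPrime hI).mp h₁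
      rw [hm.eq_of_le (IsAssociatedPrime.isPrime hp).ne_top hmp] at hass
      exact hass hp
    have hy' : IsSMulRegular (Localization.AtPrime m ⊗[R] A)
        (algebraMap R (Localization.AtPrime m) y) := by
      have h := IsWeaklyRegular.of_isLocalizedModule (Localization.AtPrime m) m.primeCompl
        (TensorProduct.mk R (Localization.AtPrime m) A 1)
        ((isWeaklyRegular_singleton_iff A y).mpr hy)
      exact (isWeaklyRegular_singleton_iff _ _).mp h
    obtain ⟨ss, hslen, hsmem, hsreg⟩ := IsLocalRing.exists_isRegular_quotSMulTop hlen hmem hreg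
      ((IsLocalization.AtPrime.to_map_mem_maximal_iff (Localization.AtPrime m) m y).mpr hym) hy'
    obtain ⟨ts, htlen, htmem, htreg⟩ := ih (QuotSMulTop y A) ss hslen hsmem
      (((QuotSMulTop.algebraMapTensorEquivTensorQuotSMulTop y A
        (Localization.AtPrime m)).isRegular_congr ss).mp hsreg)
    refine ⟨y :: ts, by simp [htlen], ?_, (isRegular_cons_iff _ _ _).mpr ⟨hy, htreg⟩⟩
    simpa [hym] using htmem

end Depth

section GradedHeight

open Order DirectSum

variable {R : Type*} [CommRing R] (𝒜 : ℤ → AddSubgroup R) [GradedRing 𝒜]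

/-- The homogeneous core of a prime ideal, as a point of the prime spectrum. -/
def PrimeSpectrum.homogeneousCore (p : PrimeSpectrum R) : PrimeSpectrum R :=
  ⟨(p.asIdeal.homogeneousCore 𝒜).toIdeal, p.isPrime.homogeneousCore⟩

theorem PrimeSpectrum.homogeneousCore_le (p : PrimeSpectrum R) : p.homogeneousCore 𝒜 ≤ p :=
  Ideal.toIdeal_homogeneousCore_le 𝒜 p.asIdeal

theorem PrimeSpectrum.homogeneousCore_mono {p q : PrimeSpectrum R} (h : p ≤ q) :
    p.homogeneousCore 𝒜 ≤ q.homogeneousCore 𝒜 :=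
  Ideal.homogeneousCore_mono 𝒜 h

theorem Ideal.IsHomogeneous.le_homogeneousCore {I J : Ideal R} (hI : I.IsHomogeneous 𝒜)
    (h : I ≤ J) : I ≤ (J.homogeneousCore 𝒜).toIdeal := by
  rw [← hI.toIdeal_homogeneousCore_eq_self]
  exact Ideal.homogeneousCore_mono 𝒜 h

/-- Among the primes containing a homogeneous ideal, the height of a prime exceeds the height of
its homogeneous core by at most one. -/
theorem PrimeSpectrum.height_le_height_homogeneousCore_add_one {s : Set (PrimeSpectrum R)}
    (hs : ∀ p ∈ s, p.homogeneousCore 𝒜 ∈ s) (p : s) :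
    height p ≤ height (⟨p.1.homogeneousCore 𝒜, hs p p.2⟩ : s) + 1 := by
  suffices ∀ n : ℕ, ∀ p : s, n ≤ height p →
      n ≤ height (⟨p.1.homogeneousCore 𝒜, hs p p.2⟩ : s) + 1 from
    ENat.forall_natCast_le_iff_le.mp fun n hn ↦ this n p hn
  intro n
  induction n with
  | zero => simp
  | succ n ih =>
    intro p hn
    obtain ⟨q, hqp, hnq⟩ : ∃ q < p, (n : ℕ∞) ≤ height q := by
      by_contra! h
      have := (height_le_coe_iff.mpr h).trans_lt' <|
        (Nat.cast_lt.mpr n.lt_succ_self).trans_le hn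
      exact this.false
    have hle : (⟨q.1.homogeneousCore 𝒜, hs q q.2⟩ : s) ≤ ⟨p.1.homogeneousCore 𝒜, hs p p.2⟩ :=
      homogeneousCore_mono 𝒜 hqp.le
    push_cast
    gcongr
    by_cases hq : q.1 ≤ p.1.homogeneousCore 𝒜
    · exact hnq.trans (height_mono (show q ≤ ⟨p.1.homogeneousCore 𝒜, hs p p.2⟩ from hq))
    · refine (ih q hnq).trans (height_add_one_le (lt_of_le_not_ge hle fun hge ↦ ?_))
      rcases (q.1.asIdeal.homogeneousCore 𝒜).isHomogeneous.le_or_le_of_isPrime 𝒜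
        (q.1.homogeneousCore 𝒜).isPrime q.1.isPrime (q.1.homogeneousCore_le 𝒜) hqp.le
        (fun x hx hxh ↦ hge (Ideal.mem_homogeneousCore_of_homogeneous_of_mem hxh hx)) with h | h
      · exact hq (le_trans h hle)
      · exact hqp.not_ge h

/-- In a Noetherian graded *local ring, every proper homogeneous ideal is contained in the
*maximal ideal. -/
theorem Ideal.IsStarMaximal.le_of_isHomogeneous [IsNoetherianRing R] {m : Ideal R}
    (hunique : ∀ I : Ideal R, Ideal.IsStarMaximal 𝒜 I → I = m) {I : Ideal R}
    (hI : I.IsHomogeneous 𝒜) (hne : I ≠ ⊤) : I ≤ m := by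
  obtain ⟨J, ⟨hJ, hJne, hIJ⟩, hmax⟩ := set_has_maximal_iff_noetherian.mpr
    (inferInstanceAs (IsNoetherian R R)) {J : Ideal R | J.IsHomogeneous 𝒜 ∧ J ≠ ⊤ ∧ I ≤ J}
    ⟨I, hI, hne, le_rfl⟩
  rw [← hunique J ⟨hJ, hJne, fun K hK hKne hJK ↦ ?_⟩]
  · exact hIJ
  · exact (eq_of_le_of_not_lt hJK (hmax K ⟨hK, hKne, hIJ.trans hJK⟩)).symm

/-- The height of every prime containing a homogeneous ideal is bounded by the height of the
maximal ideal `m`, if every proper homogeneous ideal is contained in `m`. -/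
theorem PrimeSpectrum.height_le_height_of_homogeneous_le {s : Set (PrimeSpectrum R)}
    (hs : ∀ p ∈ s, p.homogeneousCore 𝒜 ∈ s) {m : s} (hm : m.1.asIdeal.IsMaximal)
    (hle : ∀ I : Ideal R, I.IsHomogeneous 𝒜 → I ≠ ⊤ → I ≤ m.1.asIdeal) (p : s) :
    height p ≤ height m := by
  have hcore : (⟨p.1.homogeneousCore 𝒜, hs p p.2⟩ : s) ≤ m :=
    hle _ (p.1.asIdeal.homogeneousCore 𝒜).isHomogeneous (p.1.homogeneousCore 𝒜).isPrime.ne_top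
  by_cases hmp : m ≤ (⟨p.1.homogeneousCore 𝒜, hs p p.2⟩ : s)
  · have h : m.1.asIdeal = p.1.asIdeal :=
      hm.eq_of_le p.1.isPrime.ne_top (le_trans hmp (p.1.homogeneousCore_le 𝒜))
    exact height_mono (show p.1.asIdeal ≤ m.1.asIdeal from h.ge)
  · exact (height_le_height_homogeneousCore_add_one 𝒜 hs p).trans
      (height_add_one_le (lt_of_le_not_ge hcore hmp))

/-- The annihilator of a graded module is a homogeneous ideal. -/
theorem Module.annihilator_isHomogeneous {A : Type*} [AddCommGroup A] [Module R A]
    (ℳ : ℤ → AddSubgroup A) [SetLike.GradedSMul 𝒜 ℳ] [DirectSum.Decomposition ℳ] :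
    (Module.annihilator R A).IsHomogeneous 𝒜 := by
  classical
  intro i r hr
  have key : ∀ (j : ℤ) (a : A), a ∈ ℳ j → (decompose 𝒜 r i : R) • a = 0 := by
    intro j a ha
    have h : ∀ s : R, (decompose ℳ (s • a) (i + j) : A) = (decompose 𝒜 s i : R) • a := by
      intro s
      induction s using DirectSum.Decomposition.inductionOn 𝒜 with
      | zero => simp
      | @homogeneous k x =>
        have hx : (x : R) • a ∈ ℳ (k + j) := SetLike.GradedSMul.smul_mem x.2 ha
        by_cases hk : k = i
        · subst hk
          rw [decompose_of_mem_same ℳ hx, decompose_coe, of_eq_same]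
        · rw [decompose_of_mem_ne ℳ hx (by omega), decompose_coe, of_eq_of_ne _ _ _ (Ne.symm hk)]
          simp
      | add x y hx hy => simp [add_smul, decompose_add, hx, hy]
    rw [← h r, Module.mem_annihilator.mp hr a]
    simp
  rw [Module.mem_annihilator]
  intro a
  rw [← sum_support_decompose ℳ a, Finset.smul_sum]
  exact Finset.sum_eq_zero fun j _ ↦ key j _ (SetLike.coe_mem _)

end GradedHeight

section SupportDim

variable {R : Type*} [CommRing R] (p : Ideal R) [p.IsPrime] (A : Type*) [AddCommGroup A]
  [Module R A]

open Order

theorem Module.mem_support_localizedModule_iff (P : PrimeSpectrum (Localization.AtPrime p)) :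
    P ∈ Module.support (Localization.AtPrime p) (LocalizedModule p.primeCompl A) ↔
      P.comap (algebraMap R (Localization.AtPrime p)) ∈ Module.support R A := by
  simp only [Module.mem_support_iff', PrimeSpectrum.comap_asIdeal, Ideal.mem_comap]
  constructor
  · rintro ⟨x, hx⟩
    obtain ⟨⟨a, s⟩, rfl⟩ := IsLocalizedModule.mk'_surjective p.primeCompl
      (LocalizedModule.mkLinearMap p.primeCompl A) x
    refine ⟨a, fun r hr h ↦ hx _ hr ?_⟩
    simp only [Function.uncurry_apply_pair, algebraMap_smul]
    rw [← IsLocalizedModule.mk'_smul, h, IsLocalizedModule.mk'_zero]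
  · rintro ⟨a, ha⟩
    refine ⟨LocalizedModule.mkLinearMap p.primeCompl A a, fun r hr h ↦ ?_⟩
    obtain ⟨r, s, rfl⟩ := IsLocalization.exists_mk'_eq p.primeCompl r
    have h' : LocalizedModule.mkLinearMap p.primeCompl A (r • a) = 0 := by
      rw [map_smul, ← algebraMap_smul (Localization.AtPrime p) r,
        ← IsLocalization.mk'_spec' (Localization.AtPrime p) r s, mul_smul, h, smul_zero]
    obtain ⟨u, hu⟩ := (IsLocalizedModule.eq_zero_iff p.primeCompl _).mp h'
    refine ha (u * r) ?_ (by rw [mul_smul]; exact hu)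
    have hu' : algebraMap R (Localization.AtPrime p) u ∉ P.asIdeal := fun h ↦
      P.isPrime.ne_top (Ideal.eq_top_of_isUnit_mem _ h
        (IsLocalization.map_units (Localization.AtPrime p) u))
    rw [map_mul]
    refine P.isPrime.mul_notMem hu' fun h ↦ hr ?_
    rw [IsLocalization.mk'_eq_mul_mk'_one]
    exact P.asIdeal.mul_mem_right _ h

theorem Module.supportDim_localizedModule_le :
    supportDim (Localization.AtPrime p) (LocalizedModule p.primeCompl A) ≤ supportDim R A := by
  let f (P : support (Localization.AtPrime p) (LocalizedModule p.primeCompl A)) : support R A :=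
    ⟨P.1.comap (algebraMap R _), (mem_support_localizedModule_iff p A P.1).mp P.2⟩
  refine krullDim_le_of_strictMono f fun P Q h ↦ ?_
  exact (IsLocalization.AtPrime.primeSpectrumOrderIso (Localization.AtPrime p) p).strictMono h

theorem Module.height_le_supportDim_localizedModule (x : support R A) (hx : x.1.asIdeal = p) :
    (height x : WithBot ℕ∞) ≤
      supportDim (Localization.AtPrime p) (LocalizedModule p.primeCompl A) := by
  rw [height_eq_krullDim_Iic]
  let e := IsLocalization.AtPrime.primeSpectrumOrderIso (Localization.AtPrime p) p
  have hxp (y : Set.Iic x) : y.1.1.asIdeal ≤ p := hx ▸ y.2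
  have he (y : Set.Iic x) :
      (e.symm ⟨y.1.1, hxp y⟩).comap (algebraMap R (Localization.AtPrime p)) = y.1.1 :=
    congrArg Subtype.val (e.apply_symm_apply ⟨y.1.1, hxp y⟩)
  let f (y : Set.Iic x) : support (Localization.AtPrime p) (LocalizedModule p.primeCompl A) :=
    ⟨e.symm ⟨y.1.1, hxp y⟩, (mem_support_localizedModule_iff p A _).mpr (by
      rw [he y]; exact y.1.2)⟩
  exact krullDim_le_of_strictMono f fun y z h ↦ e.symm.strictMono h

end SupportDim

/-- Let `R` be a Noetherian graded *local ring with *maximal ideal `m`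
such that `R/m` is a field, and `A` a finitely generated graded `R`-module.  Then the
depth of `A` over `R` equals the depth of `A_m` over the local ring `R_m`, and the Krull
dimension of `A` over `R` equals the Krull dimension of `A_m` over `R_m`.  In particular,
for every maximal ideal `m'` of `R` one has `dim A_{m'} ≤ dim A_m`. -/
theorem statement1 {R : Type*} [CommRing R] [IsNoetherianRing R]
    (𝒜 : ℤ → AddSubgroup R) [GradedRing 𝒜]
    (m : Ideal R) (hm : Ideal.IsStarMaximal 𝒜 m)
    (hunique : ∀ I : Ideal R, Ideal.IsStarMaximal 𝒜 I → I = m)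
    (hfield : IsField (R ⧸ m))
    (A : Type*) [AddCommGroup A] [Module R A] [Module.Finite R A]
    (ℳ : ℤ → AddSubgroup A) [SetLike.GradedSMul 𝒜 ℳ] [DirectSum.Decomposition ℳ] :
    letI : m.IsPrime := (Ideal.Quotient.maximal_of_isField m hfield).isPrime
    (Ideal.moduleGrade m A =
        Ideal.moduleGrade (IsLocalRing.maximalIdeal (Localization.AtPrime m))
          (LocalizedModule m.primeCompl A) ∧
      Module.krullDimension R A =
        Module.krullDimension (Localization.AtPrime m) (LocalizedModule m.primeCompl A) ∧
      ∀ (m' : Ideal R) [m'.IsMaximal],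
        Module.krullDimension (Localization.AtPrime m') (LocalizedModule m'.primeCompl A) ≤
          Module.krullDimension (Localization.AtPrime m)
            (LocalizedModule m.primeCompl A)) := by
  have hmax : m.IsMaximal := Ideal.Quotient.maximal_of_isField m hfield
  have hprime : m.IsPrime := hmax.isPrime
  have hann : (Module.annihilator R A).IsHomogeneous 𝒜 := Module.annihilator_isHomogeneous 𝒜 ℳ
  have hle : ∀ I : Ideal R, I.IsHomogeneous 𝒜 → I ≠ ⊤ → I ≤ m := fun I hI hne ↦
    Ideal.IsStarMaximal.le_of_isHomogeneous 𝒜 hunique hI hne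
  have hsupp [Nontrivial A] : (⟨m, hprime⟩ : PrimeSpectrum R) ∈ Module.support R A :=
    Module.mem_support_iff_of_finite.mpr <| hle _ hann fun h ↦
      not_subsingleton A (Module.annihilator_eq_top_iff.mp h)
  have hdim (p : Ideal R) [p.IsPrime] :
      Module.krullDimension (Localization.AtPrime p) (LocalizedModule p.primeCompl A) =
        Module.supportDim (Localization.AtPrime p) (LocalizedModule p.primeCompl A) :=
    (Module.supportDim_eq_ringKrullDim_quotient_annihilator _ _).symm
  have hdimR : Module.krullDimension R A = Module.supportDim R A :=
    (Module.supportDim_eq_ringKrullDim_quotient_annihilator _ _).symm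
  have hdim_le : Module.supportDim R A ≤
      Module.supportDim (Localization.AtPrime m) (LocalizedModule m.primeCompl A) := by
    cases subsingleton_or_nontrivial A
    · simp [Module.supportDim_eq_bot_of_subsingleton]
    · refine le_trans ?_ (Module.height_le_supportDim_localizedModule m A ⟨_, hsupp⟩ rfl)
      rw [Module.supportDim, Order.krullDim_eq_iSup_height]
      refine iSup_le fun p ↦ WithBot.coe_le_coe.mpr ?_
      refine PrimeSpectrum.height_le_height_of_homogeneous_le 𝒜 (fun q hq ↦ ?_) hmax hle p
      rw [Module.mem_support_iff_of_finite] at hq ⊢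
      exact hann.le_homogeneousCore 𝒜 hq
  have hdim_eq := hdim_le.antisymm (Module.supportDim_localizedModule_le m A)
  refine ⟨congrArg sSup (Set.ext fun n ↦ ⟨?_, ?_⟩), ?_, fun m' _ ↦ ?_⟩
  · rintro ⟨rs, hlen, hmem, hreg⟩
    have := hreg.nontrivial
    have : Nontrivial (LocalizedModule m.primeCompl A) := Module.mem_support_iff.mp hsupp
    refine ⟨rs.map (algebraMap R (Localization.AtPrime m)), by simpa using hlen, fun r hr ↦ ?_,
      hreg.toIsWeaklyRegular.isRegular_of_isLocalizedModule_of_mem (Localization.AtPrime m) m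
        (LocalizedModule.mkLinearMap m.primeCompl A) hmem⟩
    obtain ⟨t, ht, rfl⟩ := List.mem_map.mp hr
    exact (IsLocalization.AtPrime.to_map_mem_maximal_iff (Localization.AtPrime m) m t).mpr
      (hmem t ht)
  · rintro ⟨rs, hlen, hmem, hreg⟩
    obtain ⟨ts, htlen, htmem, htreg⟩ := Ideal.IsMaximal.exists_isRegular_of_tensorProduct m
      rs.length A rs rfl hmem
      (((IsLocalizedModule.isBaseChange m.primeCompl (Localization.AtPrime m)
        (LocalizedModule.mkLinearMap m.primeCompl A)).equiv.isRegular_congr rs).mpr hreg)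
    exact ⟨ts, by rw [htlen, hlen], htmem, htreg⟩
  · rw [hdimR, hdim, hdim_eq]
  · rw [hdim, hdim, ← hdim_eq]
    exact Module.supportDim_localizedModule_le m' A
end

section
/- Let A be a finitely generated graded module over a Noetherian graded *local ring R, and let p be an associated prime ideal of A (i.e. p is the annihilator of some element of A). Then dim R/p ≥ depth A, where depth A is taken with respect to the *maximal ideal of R. -/
section GradedAssociatedPrime

open DirectSum

variable {R A : Type*} [CommRing R] [AddCommGroup A] [Module R A]

lemma decompose_smul_of_mem (𝒜 : ℤ → AddSubgroup R) (ℳ : ℤ → AddSubgroup A)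
    [SetLike.GradedSMul 𝒜 ℳ] [Decomposition ℳ] {i j : ℤ} {r : R} (hr : r ∈ 𝒜 i) (a : A) :
    (decompose ℳ (r • a) j : A) = r • (decompose ℳ a (j - i) : A) := by
  classical
  induction a using DirectSum.Decomposition.inductionOn ℳ with
  | zero => simp
  | @homogeneous k a =>
    have hmem : r • (a : A) ∈ ℳ (i + k) := SetLike.GradedSMul.smul_mem hr a.2
    by_cases h : i + k = j
    · obtain rfl : k = j - i := by omega
      rw [decompose_of_mem_same ℳ a.2, decompose_of_mem_same ℳ (by rwa [h] at hmem)]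
    · rw [decompose_of_mem_ne ℳ hmem h, decompose_of_mem_ne ℳ a.2 (by omega), smul_zero]
  | add a b ha hb => simp [ha, hb]

lemma decompose_smul_top_degree (𝒜 : ℤ → AddSubgroup R) [GradedRing 𝒜]
    (ℳ : ℤ → AddSubgroup A) [SetLike.GradedSMul 𝒜 ℳ] [Decomposition ℳ]
    {r : R} {a : A} {d s : ℤ}
    (hr : ∀ i, d < i → (decompose 𝒜 r i : R) = 0) (ha : ∀ i, s < i → (decompose ℳ a i : A) = 0) :
    (decompose ℳ (r • a) (d + s) : A) = (decompose 𝒜 r d : R) • (decompose ℳ a s : A) := by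
  classical
  conv_lhs => rw [← sum_support_decompose 𝒜 r, Finset.sum_smul, decompose_sum]
  rw [DFinsupp.finsetSum_apply, AddSubgroup.val_finsetSum, Finset.sum_eq_single d]
  · rw [decompose_smul_of_mem 𝒜 ℳ (SetLike.coe_mem _), add_sub_cancel_left]
  · intro i _ hi
    rw [decompose_smul_of_mem 𝒜 ℳ (SetLike.coe_mem _)]
    rcases lt_or_gt_of_ne hi with h | h
    · rw [ha _ (by omega), smul_zero]
    · rw [hr i h, zero_smul]
  · intro hd
    simp [DFinsupp.notMem_support_iff.mp hd]

lemma exists_top_degree {M : Type*} [AddCommGroup M] (ℳ : ℤ → AddSubgroup M)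
    [Decomposition ℳ] {a : M} (ha : a ≠ 0) :
    ∃ s, (decompose ℳ a s : M) ≠ 0 ∧ ∀ i, s < i → (decompose ℳ a i : M) = 0 := by
  classical
  have hne : (decompose ℳ a).support.Nonempty := by
    rw [Finset.nonempty_iff_ne_empty, Ne, DFinsupp.support_eq_empty]
    exact fun h ↦ ha ((decompose ℳ).injective (by rw [h, decompose_zero]))
  refine ⟨(decompose ℳ a).support.max' hne, ?_, fun i hi ↦ ?_⟩
  · simpa using Finset.max'_mem _ hne
  · by_contra h
    exact (Finset.le_max' _ i (by simpa using h)).not_gt hi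

/-- The leading component of an element killing `a` acts nilpotently on `a`. -/
lemma exists_pow_decompose_smul_eq_zero (𝒜 : ℤ → AddSubgroup R) [GradedRing 𝒜]
    (ℳ : ℤ → AddSubgroup A) [SetLike.GradedSMul 𝒜 ℳ] [Decomposition ℳ]
    {r : R} {d : ℤ}
    (hr : ∀ i, d < i → (decompose 𝒜 r i : R) = 0) (a : A) (hra : r • a = 0) :
    ∃ k : ℕ, (decompose 𝒜 r d : R) ^ k • a = 0 := by
  classical
  induction hn : (decompose ℳ a).support.card using Nat.strong_induction_on generalizing a with
  | _ n ih =>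
  subst hn
  rcases eq_or_ne a 0 with rfl | ha
  · exact ⟨0, by simp⟩
  obtain ⟨s, hs, hgt⟩ := exists_top_degree ℳ ha
  have htop : (decompose 𝒜 r d : R) • (decompose ℳ a s : A) = 0 := by
    rw [← decompose_smul_top_degree 𝒜 ℳ hr hgt, hra]
    simp
  have hcard : (decompose ℳ ((decompose 𝒜 r d : R) • a)).support.card <
      (decompose ℳ a).support.card := by
    have hsmem : s ∈ (decompose ℳ a).support := by simpa using hs
    rw [← Finset.card_erase_add_one hsmem, Nat.lt_succ_iff]
    refine Finset.card_le_card_of_injOn (· - d) (fun i hi ↦ ?_)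
      (fun i _ j _ h ↦ by simpa using h)
    have hi' : (decompose ℳ ((decompose 𝒜 r d : R) • a) i : A) ≠ 0 := by simpa using hi
    rw [decompose_smul_of_mem 𝒜 ℳ (SetLike.coe_mem _)] at hi'
    simp only [Finset.coe_erase, Set.mem_sdiff, Finset.mem_coe, Set.mem_singleton_iff]
    refine ⟨?_, fun h ↦ hi' (h ▸ htop)⟩
    rw [DFinsupp.mem_support_iff]
    exact fun h ↦ hi' (by simp [h])
  obtain ⟨k, hk⟩ := ih _ hcard _ (by rw [smul_comm, hra, smul_zero]) rfl
  exact ⟨k + 1, by rwa [pow_succ, mul_smul]⟩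

/-- Associated primes of a `ℤ`-graded module are homogeneous. -/
theorem IsAssociatedPrime.isHomogeneous (𝒜 : ℤ → AddSubgroup R) [GradedRing 𝒜]
    (ℳ : ℤ → AddSubgroup A) [SetLike.GradedSMul 𝒜 ℳ] [Decomposition ℳ]
    [IsNoetherianRing R] {p : Ideal R}
    (hp : IsAssociatedPrime p A) : p.IsHomogeneous 𝒜 := by
  classical
  obtain ⟨hprime, a, ha⟩ := isAssociatedPrime_iff.mp hp
  have hmem (r : R) : r ∈ p ↔ r • a = 0 := by
    rw [ha, Submodule.mem_colon_singleton, Submodule.mem_bot]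
  intro j r hr
  induction hn : (decompose 𝒜 r).support.card using Nat.strong_induction_on generalizing r with
  | _ n ih =>
  subst hn
  rcases eq_or_ne r 0 with rfl | hr0
  · simp
  obtain ⟨d, hd, hgt⟩ := exists_top_degree 𝒜 hr0
  have hdp : (decompose 𝒜 r d : R) ∈ p := by
    obtain ⟨k, hk⟩ := exists_pow_decompose_smul_eq_zero 𝒜 ℳ hgt a ((hmem r).mp hr)
    exact hprime.mem_of_pow_mem k ((hmem _).mpr hk)
  rcases eq_or_ne j d with rfl | hj
  · exact hdp
  have hcomp (i : ℤ) : (decompose 𝒜 (r - (decompose 𝒜 r d : R)) i : R) =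
      if i = d then 0 else (decompose 𝒜 r i : R) := by
    rw [decompose_sub, DirectSum.sub_apply, AddSubgroupClass.coe_sub]
    split_ifs with h
    · rw [h, decompose_of_mem_same 𝒜 (SetLike.coe_mem _), sub_self]
    · rw [decompose_of_mem_ne 𝒜 (SetLike.coe_mem _) (Ne.symm h), sub_zero]
  have hcard : (decompose 𝒜 (r - (decompose 𝒜 r d : R))).support.card <
      (decompose 𝒜 r).support.card := by
    refine Finset.card_lt_card (Finset.ssubset_iff_of_subset (fun i hi ↦ ?_) |>.mpr
      ⟨d, by simpa using hd, fun h ↦ ?_⟩)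
    · have hi' : (decompose 𝒜 (r - (decompose 𝒜 r d : R)) i : R) ≠ 0 :=
        fun h ↦ DFinsupp.mem_support_iff.mp hi (Subtype.ext h)
      rw [hcomp] at hi'
      rw [DFinsupp.mem_support_iff]
      exact fun h ↦ hi' (by simp [h])
    · exact DFinsupp.mem_support_iff.mp h (Subtype.ext (by rw [hcomp, if_pos rfl]; rfl))
  have hj' := ih _ hcard (sub_mem hr hdp) rfl
  rwa [hcomp, if_neg hj] at hj'

end GradedAssociatedPrime

lemma Ideal.exists_isStarMaximal_le {R : Type*} [CommRing R] [IsNoetherianRing R]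
    (𝒜 : ℤ → AddSubgroup R) [GradedRing 𝒜] {p : Ideal R} (hp : p.IsHomogeneous 𝒜)
    (hne : p ≠ ⊤) : ∃ m : Ideal R, Ideal.IsStarMaximal 𝒜 m ∧ p ≤ m := by
  obtain ⟨m, ⟨hm, hm', hpm⟩, hmax⟩ := set_has_maximal_iff_noetherian.mpr
    (inferInstance : IsNoetherian R R)
    {I : Ideal R | I.IsHomogeneous 𝒜 ∧ I ≠ ⊤ ∧ p ≤ I} ⟨p, hp, hne, le_rfl⟩
  exact ⟨m, ⟨hm, hm', fun I hI hI' hle ↦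
    (eq_of_le_of_not_lt hle (hmax I ⟨hI, hI', hpm.trans hle⟩)).symm⟩, hpm⟩

open scoped Pointwise in
/-- If `x` is `M`-regular and `p` is an associated prime of `M`, then inside any prime `P`
containing `p` and `x` there is an associated prime of `M / xM` containing `p` and `x`. -/
lemma exists_isAssociatedPrime_quotSMulTop {R M : Type*} [CommRing R] [IsNoetherianRing R]
    [AddCommGroup M] [Module R M] [Module.Finite R M] {p P : Ideal R} [hP : P.IsPrime]
    (hp : IsAssociatedPrime p M) (hpP : p ≤ P) {x : R} (hx : x ∈ P) (hreg : IsSMulRegular M x) :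
    ∃ q : Ideal R, IsAssociatedPrime q (QuotSMulTop x M) ∧ p ≤ q ∧ x ∈ q ∧ q ≤ P := by
  obtain ⟨hprime, a, ha⟩ := isAssociatedPrime_iff.mp hp
  have hmem (r : R) : r ∈ p ↔ r • a = 0 := by
    rw [ha, Submodule.mem_colon_singleton, Submodule.mem_bot]
  let N : Submodule R M := Submodule.torsionBySet R M p
  have hN (y : M) : y ∈ N ↔ ∀ r ∈ p, r • y = 0 := by
    simp [N, Submodule.mem_torsionBySet_iff]
  have hsupp : (⟨P, hP⟩ : PrimeSpectrum R) ∈ Module.support R N := by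
    rw [Module.mem_support_iff']
    refine ⟨⟨a, (hN a).mpr fun r hr ↦ (hmem r).mp hr⟩, fun r hr h ↦ hr (hpP ?_)⟩
    exact (hmem r).mpr (congrArg Subtype.val h)
  have hsupp' : (⟨P, hP⟩ : PrimeSpectrum R) ∈ Module.support R (QuotSMulTop x N) := by
    rw [Module.support_quotSMulTop]
    exact ⟨hsupp, by simpa using hx⟩
  obtain ⟨q, hq, hqP⟩ := Ideal.exists_minimalPrimes_le (Module.mem_support_iff_of_finite.mp hsupp')
  have hinj : Function.Injective (QuotSMulTop.map x N.subtype) := by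
    rw [injective_iff_map_eq_zero]
    intro z hz
    obtain ⟨y, rfl⟩ := Submodule.Quotient.mk_surjective _ z
    have hy : (y : M) ∈ x • (⊤ : Submodule R M) := (Submodule.Quotient.mk_eq_zero _).mp hz
    obtain ⟨w, -, hw⟩ := (Submodule.mem_smul_pointwise_iff_exists _ _ _).mp hy
    have hwN : w ∈ N := (hN w).mpr fun r hr ↦ hreg.right_eq_zero_of_smul <| by
      rw [smul_comm, hw, (hN y).mp y.2 r hr]
    exact (Submodule.Quotient.mk_eq_zero _).mpr
      ((Submodule.mem_smul_pointwise_iff_exists _ _ _).mpr ⟨⟨w, hwN⟩, trivial, Subtype.ext hw⟩)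
  have hann : Module.annihilator R (QuotSMulTop x N) ≤ q := hq.1.2
  refine ⟨q, (Module.associatedPrimes.minimalPrimes_annihilator_subset_associatedPrimes R _
    hq).map_of_injective _ hinj, fun r hr ↦ hann ?_, hann ?_, hqP⟩
  · rw [Module.mem_annihilator]
    intro z
    obtain ⟨y, rfl⟩ := Submodule.Quotient.mk_surjective _ z
    rw [← Submodule.Quotient.mk_smul, show r • y = 0 from Subtype.ext ((hN y).mp y.2 r hr),
      Submodule.Quotient.mk_zero]
  · rw [Module.mem_annihilator]
    intro z
    obtain ⟨y, rfl⟩ := Submodule.Quotient.mk_surjective _ z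
    rw [← Submodule.Quotient.mk_smul, Submodule.Quotient.mk_eq_zero]
    exact Submodule.smul_mem_pointwise_smul _ _ _ trivial

theorem RingTheory.Sequence.IsWeaklyRegular.length_le_ringKrullDim_quotient {R : Type*}
    [CommRing R] [IsNoetherianRing R] {P : Ideal R} [P.IsPrime] {rs : List R}
    (hrs : ∀ r ∈ rs, r ∈ P) {M : Type*} [AddCommGroup M] [Module R M] [Module.Finite R M]
    (hreg : IsWeaklyRegular M rs) {p : Ideal R} (hp : IsAssociatedPrime p M) (hpP : p ≤ P) :
    (rs.length : WithBot ℕ∞) ≤ ringKrullDim (R ⧸ p) := by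
  induction rs generalizing M p with
  | nil =>
    have := hp.isPrime
    simpa using ringKrullDim_nonneg_of_nontrivial
  | cons x rs ih =>
    obtain ⟨hx, hreg⟩ := (isWeaklyRegular_cons_iff M x rs).mp hreg
    obtain ⟨q, hq, hpq, hxq, hqP⟩ :=
      exists_isAssociatedPrime_quotSMulTop hp hpP (hrs x (by simp)) hx
    have hxp : x ∉ p := by
      obtain ⟨hprime, a, ha⟩ := isAssociatedPrime_iff.mp hp
      intro h
      rw [ha, Submodule.mem_colon_singleton, Submodule.mem_bot] at h
      refine hprime.ne_top ((Ideal.eq_top_iff_one p).mpr ?_)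
      rw [ha, Submodule.mem_colon_singleton, hx.right_eq_zero_of_smul h]
      simp
    have := hp.isPrime
    have hdim : ringKrullDim (R ⧸ q) + 1 ≤ ringKrullDim (R ⧸ p) :=
      ringKrullDim_succ_le_of_surjective (Ideal.Quotient.factor hpq)
        (Ideal.Quotient.factor_surjective hpq) (r := Ideal.Quotient.mk p x)
        (mem_nonZeroDivisors_of_ne_zero (by rwa [Ne, Ideal.Quotient.eq_zero_iff_mem]))
        (by rwa [Ideal.Quotient.factor_mk, Ideal.Quotient.eq_zero_iff_mem])
    refine le_trans ?_ hdim
    rw [List.length_cons, Nat.cast_add, Nat.cast_one]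
    gcongr
    exact ih (fun r hr ↦ hrs r (by simp [hr])) hreg hq hqP

/-- Let `A` be a finitely generated graded module over a Noetherian
graded *local ring `R` with *maximal ideal `m`, and let `p` be an associated prime of
`A` (i.e. a prime ideal which is the annihilator of some element of `A`).  Then
`dim R/p ≥ depth A`, where `depth A = grade(m, A)`. -/
theorem statement6 {R : Type*} [CommRing R] [IsNoetherianRing R]
    (𝒜 : ℤ → AddSubgroup R) [GradedRing 𝒜]
    (m : Ideal R) (hm : Ideal.IsStarMaximal 𝒜 m)
    (hunique : ∀ I : Ideal R, Ideal.IsStarMaximal 𝒜 I → I = m)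
    (A : Type*) [AddCommGroup A] [Module R A] [Module.Finite R A]
    (ℳ : ℤ → AddSubgroup A) [SetLike.GradedSMul 𝒜 ℳ] [DirectSum.Decomposition ℳ]
    (p : Ideal R) (hp : IsAssociatedPrime p A) :
    (Ideal.moduleGrade m A : WithBot ℕ∞) ≤ ringKrullDim (R ⧸ p) := by
  obtain ⟨m', hm', hpm⟩ := Ideal.exists_isStarMaximal_le 𝒜 (hp.isHomogeneous 𝒜 ℳ) hp.isPrime.ne_top
  rw [hunique m' hm'] at hpm
  obtain ⟨P, hP, hmP⟩ := Ideal.exists_le_maximal m hm.2.1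
  have := hP.isPrime
  have := hp.isPrime
  obtain ⟨d, hd⟩ : ∃ d : ℕ∞, ringKrullDim (R ⧸ p) = d :=
    (WithBot.ne_bot_iff_exists.mp
      ((WithBot.bot_lt_coe _).trans_le ringKrullDim_nonneg_of_nontrivial).ne').imp fun _ h ↦ h.symm
  rw [hd]
  refine WithBot.coe_le_coe.mpr (sSup_le ?_)
  rintro _ ⟨rs, rfl, hrs, hreg⟩
  have := hreg.toIsWeaklyRegular.length_le_ringKrullDim_quotient
    (fun r hr ↦ hmP (hrs r hr)) hp (hpm.trans hmP)
  rw [hd] at this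
  exact WithBot.coe_le_coe.mp this
end
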